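/- arXiv:1112.3193 — 2 statements merged into one kernel-verified Lean document; each statement's English description precedes it below -/
import Mathlib

section
/- Let T be a tree and let λ be an eigenvalue of T with multiplicity r ≥ 1. Then the number of connected components of the induced subgraph T[V(T) \ N_λ(T)] is at least r. -/
open SimpleGraph

open scoped Classical

/-- The real adjacency matrix of a simple graph. -/
noncomputable def adjMat {V : Type*} (G : SimpleGraph V) : Matrix V V ℝ :=
  fun u v => if G.Adj u v then 1 else 0

/-- The eigenspace `{x : A x = μ x}` of the adjacency matrix of `G`. -/
noncomputable def eigSpace {V : Type*} [Fintype V] (G : SimpleGraph V) (μ : ℝ) :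
    Submodule ℝ (V → ℝ) :=
  LinearMap.ker ((adjMat G).mulVecLin - μ • LinearMap.id)

/-- `x` is an eigenvector of `G` for eigenvalue `μ`. -/
def IsEigenvector {V : Type*} [Fintype V] (G : SimpleGraph V) (μ : ℝ) (x : V → ℝ) : Prop :=
  x ≠ 0 ∧ (adjMat G).mulVec x = μ • x

/-- `N_μ(G)`: vertices on which every eigenvector of `G` for `μ` vanishes. -/
def nSet {V : Type*} [Fintype V] (G : SimpleGraph V) (μ : ℝ) : Set V :=
  {v | ∀ x : V → ℝ, IsEigenvector G μ x → x v = 0}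

/-- `N^C_μ(G)`: vertices of `N_μ(G)` with a neighbor outside `N_μ(G)`. -/
def ncSet {V : Type*} [Fintype V] (G : SimpleGraph V) (μ : ℝ) : Set V :=
  {v | v ∈ nSet G μ ∧ ∃ w, G.Adj v w ∧ w ∉ nSet G μ}

/-- `C` is the vertex set of a connected component of the induced subgraph `G[S]`. -/
def IsCompOf {V : Type*} (G : SimpleGraph V) (S C : Set V) : Prop :=
  ∃ c : (G.induce S).ConnectedComponent, C = Subtype.val '' c.supp

theorem mem_eigSpace_iff {V : Type*} [Fintype V] {G : SimpleGraph V} {μ : ℝ} {x : V → ℝ} :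
    x ∈ eigSpace G μ ↔ (adjMat G).mulVec x = μ • x := by
  simp [eigSpace, sub_eq_zero]

/-- An antisymmetric function with zero divergence that is supported on the edges of an acyclic
graph vanishes on every edge. -/
theorem SimpleGraph.IsAcyclic.flow_eq_zero {V : Type*} [Fintype V] {G : SimpleGraph V}
    (hG : G.IsAcyclic) (f : V → V → ℝ) (hanti : ∀ u v, f u v = -f v u)
    (hsupp : ∀ u v, ¬ G.Adj u v → f u v = 0) (hdiv : ∀ u, ∑ v, f u v = 0)
    {u v : V} (huv : G.Adj u v) : f u v = 0 := by
  have hbridge : G.IsBridge s(u, v) := isAcyclic_iff_forall_adj_isBridge.1 hG huv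
  have hnr : ¬ (G.deleteEdges {s(u, v)}).Reachable u v := isBridge_iff.1 hbridge
  set H := G.deleteEdges {s(u, v)} with hH
  let S : Finset V := Finset.univ.filter fun w => H.Reachable u w
  have hu : u ∈ S := by simp [S]
  have hv : v ∉ S := by simpa [S] using hnr
  have hcross : ∀ a ∈ S, ∀ b ∈ Sᶜ, ¬ (a = u ∧ b = v) → f a b = 0 := by
    intro a ha b hb hne
    apply hsupp
    intro hab
    have ha' : H.Reachable u a := by simpa [S] using ha
    have hb' : ¬ H.Reachable u b := by simpa [S] using hb
    refine hb' (ha'.trans (Adj.reachable ?_))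
    rw [hH, deleteEdges_adj]
    refine ⟨hab, fun h => ?_⟩
    rcases Sym2.eq_iff.1 (Set.mem_singleton_iff.1 h) with h | ⟨rfl, rfl⟩
    · exact hne h
    · exact hv ha
  have hinner : ∑ a ∈ S, ∑ b ∈ S, f a b = 0 := by
    have h : ∑ a ∈ S, ∑ b ∈ S, f a b = -∑ a ∈ S, ∑ b ∈ S, f a b := by
      conv_lhs => rw [Finset.sum_comm]
      simp_rw [← Finset.sum_neg_distrib]
      exact Finset.sum_congr rfl fun a _ => Finset.sum_congr rfl fun b _ => hanti b a
    linarith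
  have houter : ∑ a ∈ S, ∑ b ∈ Sᶜ, f a b = f u v := by
    rw [Finset.sum_eq_single_of_mem u hu, Finset.sum_eq_single_of_mem v (by simpa using hv)]
    · exact fun b hb hbv => hcross u hu b hb fun h => hbv h.2
    · exact fun a ha hau => Finset.sum_eq_zero fun b hb => hcross a ha b hb fun h => hau h.1
  have htotal : ∑ a ∈ S, (∑ b ∈ S, f a b + ∑ b ∈ Sᶜ, f a b) = 0 :=
    Finset.sum_eq_zero fun a _ => by rw [Finset.sum_add_sum_compl, hdiv]
  rw [Finset.sum_add_distrib, hinner, houter, zero_add] at htotal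
  exact htotal

/-- Two eigenvectors of an acyclic graph for the same eigenvalue are proportional along every
edge. -/
theorem SimpleGraph.IsAcyclic.mul_eq_mul_of_adj {V : Type*} [Fintype V] {G : SimpleGraph V}
    (hG : G.IsAcyclic) {μ : ℝ} {x y : V → ℝ} (hx : (adjMat G).mulVec x = μ • x)
    (hy : (adjMat G).mulVec y = μ • y) {u v : V} (huv : G.Adj u v) : x u * y v = x v * y u := by
  have h := hG.flow_eq_zero (fun a b => adjMat G a b * (x a * y b - x b * y a))
    (fun a b => by
      have : adjMat G a b = adjMat G b a := by simp [adjMat, G.adj_comm]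
      simp only [this]; ring)
    (fun a b hab => by simp [adjMat, hab])
    (fun a => by
      have hxa : ∑ b, adjMat G a b * x b = μ * x a := congrFun hx a
      have hya : ∑ b, adjMat G a b * y b = μ * y a := congrFun hy a
      calc ∑ b, adjMat G a b * (x a * y b - x b * y a)
          = x a * ∑ b, adjMat G a b * y b - y a * ∑ b, adjMat G a b * x b := by
            rw [Finset.mul_sum, Finset.mul_sum, ← Finset.sum_sub_distrib]
            exact Finset.sum_congr rfl fun b _ => by ring
        _ = 0 := by rw [hxa, hya]; ring) huv
  simp only [adjMat, huv, if_true, one_mul] at h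
  linarith

theorem stmt_9 {V : Type*} [Fintype V] (G : SimpleGraph V) (hT : G.IsTree) (μ : ℝ)
    (r : ℕ) (hr : 1 ≤ r) (hmult : Module.finrank ℝ (eigSpace G μ) = r) :
    r ≤ Nat.card (G.induce ((nSet G μ)ᶜ)).ConnectedComponent := by
  let K := (G.induce ((nSet G μ)ᶜ)).ConnectedComponent
  let rep : K → V := fun c => c.out.1
  let φ : eigSpace G μ →ₗ[ℝ] (K → ℝ) :=
    (LinearMap.funLeft ℝ ℝ rep).comp (eigSpace G μ).subtype
  have hφ : Function.Injective φ := by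
    rw [injective_iff_map_eq_zero]
    rintro ⟨y, hy⟩ h0
    have hy' := mem_eigSpace_iff.1 hy
    have hstep : ∀ a b : ((nSet G μ)ᶜ : Set V), (G.induce ((nSet G μ)ᶜ)).Walk a b →
        y a = 0 → y b = 0 := by
      intro a b w
      induction w with
      | nil => exact id
      | @cons a c _ hac _ ih =>
        intro ha
        apply ih
        obtain ⟨x, hx, hxa⟩ : ∃ x, IsEigenvector G μ x ∧ x a ≠ 0 := by
          simpa [nSet] using a.2
        have h := hT.isAcyclic.mul_eq_mul_of_adj hx.2 hy' (u := a) (v := c) hac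
        rw [ha, mul_zero] at h
        exact (mul_eq_zero.1 h).resolve_left hxa
    ext v
    change y v = 0
    by_cases hv : v ∈ nSet G μ
    · by_cases hy0 : y = 0
      · simp [hy0]
      · exact hv y ⟨hy0, hy'⟩
    · let c : K := connectedComponentMk _ ⟨v, hv⟩
      have hc : (G.induce ((nSet G μ)ᶜ)).Reachable c.out ⟨v, hv⟩ :=
        ConnectedComponent.exact c.out_eq
      obtain ⟨w⟩ := hc
      exact hstep _ _ w (congrFun h0 c)
  have h := LinearMap.finrank_le_finrank_of_injective hφ
  rwa [hmult, Module.finrank_fintype_fun_eq_card, ← Nat.card_eq_fintype_card] at h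
end

section
/- Let T be a tree on n vertices, let ν(T) be the number of edges in a maximum matching of T, and let A be the adjacency matrix of T. Then the nullity of T (the dimension of the null space of A over ℝ) equals n − 2·ν(T), i.e., it equals the number of vertices missed by any maximum matching of T. -/
open SimpleGraph

open scoped Classical

/-- A matching of `G`: a set of edges of `G`, pairwise non-incident. -/
def IsMatching {V : Type*} (G : SimpleGraph V) (M : Set (Sym2 V)) : Prop :=
  M ⊆ G.edgeSet ∧ M.Pairwise fun e f => ∀ v, ¬(v ∈ e ∧ v ∈ f)

/-- The matching `M` covers the vertex `v`. -/
def MCovers {V : Type*} (M : Set (Sym2 V)) (v : V) : Prop := ∃ e ∈ M, v ∈ e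

/-- `M` is a maximum matching of `G`. -/
def IsMaxMatching {V : Type*} (G : SimpleGraph V) (M : Set (Sym2 V)) : Prop :=
  IsMatching G M ∧ ∀ M', IsMatching G M' → M'.ncard ≤ M.ncard

lemma SimpleGraph.IsAcyclic.exists_leaf_of_adj {V : Type*} [Finite V] {G : SimpleGraph V}
    (hG : G.IsAcyclic) {a b : V} (hab : G.Adj a b) :
    ∃ u w, G.Adj u w ∧ ∀ x, G.Adj u x → x = w := by
  have : Nonempty V := ⟨a⟩
  obtain ⟨u, v, p, hp, hmax⟩ := Walk.exists_isPath_forall_isPath_length_le_length G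
  have hpos : 1 ≤ p.length := hmax _ _ (Walk.cons hab .nil) (by simp [hab.ne])
  have hnil : ¬ p.Nil := fun h => by simp [Walk.length_eq_zero_iff.mpr h] at hpos
  refine ⟨u, p.snd, p.adj_snd hnil, fun w hadj => ?_⟩
  apply hG.eq_snd_of_adj_start hp hadj
  have : ¬(p.cons hadj.symm).IsPath := by grind [Walk.length_cons]
  grind [hp.cons]

lemma mem_eigSpace_zero {V : Type*} [Fintype V] {G : SimpleGraph V} {x : V → ℝ} :
    x ∈ eigSpace G 0 ↔ ∀ v, (adjMat G).mulVec x v = 0 := by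
  simp [eigSpace, funext_iff]

lemma adjMat_mulVec_apply {V : Type*} [Fintype V] (G : SimpleGraph V) (x : V → ℝ) (v : V) :
    (adjMat G).mulVec x v = ∑ y, if G.Adj v y then x y else 0 := by
  simp [Matrix.mulVec, dotProduct, adjMat]

lemma adjMat_mulVec_leaf {V : Type*} [Fintype V] {G : SimpleGraph V} {u w : V}
    (huw : G.Adj u w) (hu : ∀ x, G.Adj u x → x = w) (x : V → ℝ) :
    (adjMat G).mulVec x u = x w := by
  rw [adjMat_mulVec_apply, Finset.sum_eq_single w]
  · simp [huw]
  · intro b _ hb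
    exact if_neg fun h => hb (hu b h)
  · simp

lemma adjMat_deleteIncidenceSet_mulVec_self {V : Type*} [Fintype V] (G : SimpleGraph V) (w : V)
    (x : V → ℝ) : (adjMat (G.deleteIncidenceSet w)).mulVec x w = 0 := by
  simp [adjMat_mulVec_apply, deleteIncidenceSet_adj]

lemma adjMat_deleteIncidenceSet_mulVec_of_ne {V : Type*} [Fintype V] (G : SimpleGraph V)
    {v w : V} (hv : v ≠ w) (x : V → ℝ) :
    (adjMat (G.deleteIncidenceSet w)).mulVec x v =
      (adjMat G).mulVec x v - if G.Adj v w then x w else 0 := by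
  simp only [adjMat_mulVec_apply, deleteIncidenceSet_adj]
  rw [eq_sub_iff_add_eq, ← Finset.sum_erase_add _ _ (Finset.mem_univ w),
    ← Finset.sum_erase_add _ (fun y => if G.Adj v y then x y else 0) (Finset.mem_univ w)]
  simp only [ne_eq, not_true_eq_false, and_false, if_false, add_zero, add_left_inj]
  refine Finset.sum_congr rfl fun y hy => ?_
  simp [hv, Finset.ne_of_mem_erase hy]

/-- Deleting all edges at the neighbor of a leaf raises the nullity by two. -/
lemma finrank_eigSpace_deleteIncidenceSet {V : Type*} [Fintype V] {G : SimpleGraph V} {u w : V}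
    (huw : G.Adj u w) (hu : ∀ x, G.Adj u x → x = w) :
    Module.finrank ℝ (eigSpace (G.deleteIncidenceSet w) 0) =
      Module.finrank ℝ (eigSpace G 0) + 2 := by
  have hle : eigSpace G 0 ≤ eigSpace (G.deleteIncidenceSet w) 0 := by
    intro x hx
    rw [mem_eigSpace_zero] at hx ⊢
    intro v
    by_cases hv : v = w
    · rw [hv, adjMat_deleteIncidenceSet_mulVec_self]
    · have hxw : x w = 0 := by rw [← adjMat_mulVec_leaf huw hu x, hx]
      rw [adjMat_deleteIncidenceSet_mulVec_of_ne G hv, hx, hxw]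
      simp
  let F : (V → ℝ) →ₗ[ℝ] ℝ × ℝ :=
    (LinearMap.proj w).prod (LinearMap.proj w ∘ₗ (adjMat G).mulVecLin)
  have hF (x : V → ℝ) : F x = (x w, (adjMat G).mulVec x w) := rfl
  let f := F.domRestrict (eigSpace (G.deleteIncidenceSet w) 0)
  have hker : LinearMap.ker f =
      (eigSpace G 0).comap (eigSpace (G.deleteIncidenceSet w) 0).subtype := by
    ext ⟨x, hx'⟩
    simp only [f, LinearMap.mem_ker, LinearMap.domRestrict_apply, hF, Prod.mk_eq_zero,
      Submodule.mem_comap, Submodule.subtype_apply]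
    rw [mem_eigSpace_zero] at hx' ⊢
    refine ⟨fun ⟨h1, h2⟩ v => ?_, fun h => ⟨?_, h w⟩⟩
    · by_cases hv : v = w
      · rw [hv, h2]
      · simpa [adjMat_deleteIncidenceSet_mulVec_of_ne G hv, h1] using hx' v
    · rw [← adjMat_mulVec_leaf huw hu x, h]
  have hmem {a : V} (ha : ∀ v, ¬ (G.deleteIncidenceSet w).Adj v a) (c : ℝ) :
      Pi.single a c ∈ eigSpace (G.deleteIncidenceSet w) 0 := by
    rw [mem_eigSpace_zero]
    intro v
    rw [adjMat_mulVec_apply]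
    refine Finset.sum_eq_zero fun y _ => ?_
    by_cases hy : y = a
    · simp [hy, ha v]
    · simp [hy]
  have hsurj : Function.Surjective f := by
    rintro ⟨a, b⟩
    have hw : ∀ v, ¬ (G.deleteIncidenceSet w).Adj v w := by simp [deleteIncidenceSet_adj]
    have hu' : ∀ v, ¬ (G.deleteIncidenceSet w).Adj v u := fun v hv => by
      rw [deleteIncidenceSet_adj] at hv
      exact hv.2.1 (hu v hv.1.symm)
    refine ⟨⟨Pi.single w a, hmem hw a⟩ + ⟨Pi.single u b, hmem hu' b⟩, ?_⟩
    rw [map_add]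
    simp only [f, LinearMap.domRestrict_apply, hF]
    simp [adjMat, huw.symm, huw.ne']
  have h1 := LinearMap.finrank_range_add_finrank_ker f
  rw [LinearMap.range_eq_top.mpr hsurj, finrank_top, hker,
    (Submodule.comapSubtypeEquivOfLe hle).finrank_eq] at h1
  simp only [Module.finrank_prod, Module.finrank_self] at h1
  omega

lemma IsMatching.diff_incidenceSet {V : Type*} {G : SimpleGraph V} {M : Set (Sym2 V)}
    (hM : IsMatching G M) (w : V) :
    IsMatching (G.deleteIncidenceSet w) (M \ {e | w ∈ e}) := by
  refine ⟨fun e he => ?_, hM.2.mono Set.sdiff_subset⟩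
  rw [edgeSet_deleteIncidenceSet]
  exact ⟨hM.1 he.1, fun h => he.2 h.2⟩

lemma IsMatching.ncard_le_ncard_diff_incidenceSet_add_one {V : Type*} [Finite V]
    {G : SimpleGraph V} {M : Set (Sym2 V)} (hM : IsMatching G M) (w : V) :
    M.ncard ≤ (M \ {e | w ∈ e}).ncard + 1 := by
  rw [← Set.ncard_inter_add_ncard_sdiff_eq_ncard M {e | w ∈ e}, add_comm]
  gcongr
  rw [Set.ncard_le_one_iff]
  intro e f he hf
  by_contra hne
  exact hM.2 he.1 hf.1 hne w ⟨he.2, hf.2⟩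

lemma IsMatching.insert_leaf {V : Type*} {G : SimpleGraph V} {u w : V} {M : Set (Sym2 V)}
    (huw : G.Adj u w) (hu : ∀ x, G.Adj u x → x = w)
    (hM : IsMatching (G.deleteIncidenceSet w) M) :
    IsMatching G (insert s(u, w) M) ∧ s(u, w) ∉ M := by
  have hw : ∀ e ∈ M, w ∉ e := fun e he hwe => by
    have := hM.1 he
    rw [edgeSet_deleteIncidenceSet] at this
    exact this.2 ⟨this.1, hwe⟩
  have huM : ∀ e ∈ M, u ∉ e := by
    intro e he hue
    have hG := edgeSet_mono (deleteIncidenceSet_le G w) (hM.1 he)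
    obtain ⟨y, rfl⟩ := Sym2.mem_iff_exists.mp hue
    exact hw _ he (by simp [hu y hG])
  refine ⟨⟨Set.insert_subset huw (hM.1.trans (edgeSet_mono (deleteIncidenceSet_le G w))), ?_⟩,
    fun h => hw _ h (by simp)⟩
  refine hM.2.insert fun e he _ => ⟨?_, ?_⟩ <;> rintro v ⟨h1, h2⟩
  · rcases Sym2.mem_iff.mp h1 with rfl | rfl
    exacts [huM e he h2, hw e he h2]
  · rcases Sym2.mem_iff.mp h2 with rfl | rfl
    exacts [huM e he h1, hw e he h1]

/-- In a forest every matching `M` satisfies `2 |M| + nullity ≤ |V|`, with equality for some `M`. -/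
lemma SimpleGraph.IsAcyclic.matching_finrank_eigSpace {V : Type*} [Fintype V]
    (G : SimpleGraph V) (hG : G.IsAcyclic) :
    (∃ M, IsMatching G M ∧
      2 * M.ncard + Module.finrank ℝ (eigSpace G 0) = Fintype.card V) ∧
    ∀ M, IsMatching G M →
      2 * M.ncard + Module.finrank ℝ (eigSpace G 0) ≤ Fintype.card V := by
  induction hn : G.edgeSet.ncard using Nat.strong_induction_on generalizing G with
  | _ n ih =>
  by_cases hE : ∃ a b, G.Adj a b
  · obtain ⟨a, b, hab⟩ := hE
    obtain ⟨u, w, huw, hu⟩ := hG.exists_leaf_of_adj hab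
    have hlt : (G.deleteIncidenceSet w).edgeSet.ncard < n := by
      rw [← hn]
      refine Set.ncard_lt_ncard
        ((Set.ssubset_iff_of_subset (edgeSet_mono (deleteIncidenceSet_le G w))).mpr
          ⟨s(u, w), huw, ?_⟩)
      simp [deleteIncidenceSet_adj]
    have hfin := finrank_eigSpace_deleteIncidenceSet huw hu
    obtain ⟨⟨M, hM, hMc⟩, hall⟩ := ih _ hlt _ (hG.anti (deleteIncidenceSet_le G w)) rfl
    constructor
    · obtain ⟨hM', hnot⟩ := hM.insert_leaf huw hu
      refine ⟨_, hM', ?_⟩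
      rw [Set.ncard_insert_of_notMem hnot]
      omega
    · intro N hN
      have h1 := hall _ (hN.diff_incidenceSet w)
      have h2 := hN.ncard_le_ncard_diff_incidenceSet_add_one w
      omega
  · push Not at hE
    have htop : eigSpace G 0 = ⊤ := by
      ext x
      simp [mem_eigSpace_zero, adjMat_mulVec_apply, hE]
    have hbot : G.edgeSet = ∅ := by
      rw [edgeSet_eq_empty]
      ext a b
      simp [hE]
    rw [htop, finrank_top, Module.finrank_fintype_fun_eq_card]
    refine ⟨⟨∅, by simp [IsMatching], by simp⟩, fun M hM => ?_⟩
    have : M = ∅ := Set.subset_empty_iff.mp (hbot ▸ hM.1)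
    simp [this]

lemma IsMatching.ncard_not_mCovers {V : Type*} [Fintype V] {G : SimpleGraph V} {M : Set (Sym2 V)}
    (hM : IsMatching G M) :
    2 * M.ncard + ({v | ¬MCovers M v} : Set V).ncard = Fintype.card V := by
  have hcov : ({v | MCovers M v} : Set V) = (M.toFinset.biUnion Sym2.toFinset : Finset V) := by
    ext v
    simp [MCovers]
  have hcard : ({v | MCovers M v} : Set V).ncard = 2 * M.ncard := by
    rw [hcov, Set.ncard_coe_finset, Finset.card_biUnion, Finset.sum_const_nat (m := 2),
      Set.ncard_eq_toFinset_card', mul_comm]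
    · intro e he
      exact Sym2.card_toFinset_of_not_isDiag e
        (G.not_isDiag_of_mem_edgeSet (hM.1 (Set.mem_toFinset.mp he)))
    · intro e he f hf hne
      rw [Function.onFun, Finset.disjoint_left]
      intro v h1 h2
      exact hM.2 (Set.mem_toFinset.mp he) (Set.mem_toFinset.mp hf) hne v
        ⟨Sym2.mem_toFinset.mp h1, Sym2.mem_toFinset.mp h2⟩
  rw [← hcard, ← Nat.card_eq_fintype_card]
  exact Set.ncard_add_ncard_compl {v | MCovers M v}

theorem stmt_13 {V : Type*} [Fintype V] (G : SimpleGraph V) (hT : G.IsTree)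
    (M : Set (Sym2 V)) (hM : IsMaxMatching G M) :
    (Module.finrank ℝ (eigSpace G 0) : ℤ) = Fintype.card V - 2 * M.ncard ∧
      Module.finrank ℝ (eigSpace G 0) = ({v | ¬MCovers M v} : Set V).ncard := by
  obtain ⟨⟨N, hN, hNc⟩, hall⟩ := hT.isAcyclic.matching_finrank_eigSpace
  have h1 := hall M hM.1
  have h2 := hM.2 N hN
  have h3 := hM.1.ncard_not_mCovers
  omega
end
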